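/- For every p ∈ (0,1), the function p ↦ p²·K(p) − K(p) + E(p) is differentiable at p with derivative equal to p·K(p), and this derivative is strictly positive. -/

import Mathlib

/-- Complete elliptic integral of the first kind. -/
noncomputable def ellipticK (p : ℝ) : ℝ :=
  ∫ z in (0:ℝ)..1, 1 / (Real.sqrt (1 - z ^ 2) * Real.sqrt (1 - p ^ 2 * z ^ 2))

/-- Complete elliptic integral of the second kind. -/
noncomputable def ellipticE (p : ℝ) : ℝ :=
  ∫ z in (0:ℝ)..1, Real.sqrt (1 - p ^ 2 * z ^ 2) / Real.sqrt (1 - z ^ 2)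

open MeasureTheory Set intervalIntegral Interval Topology

theorem intervalIntegrable_one_div_sqrt_one_sub_sq :
    IntervalIntegrable (fun z : ℝ => 1 / √(1 - z ^ 2)) volume 0 1 := by
  rw [intervalIntegrable_iff_integrableOn_Ioc_of_le zero_le_one]
  refine integrableOn_deriv_of_nonneg (g := Real.arcsin) Real.continuous_arcsin.continuousOn
    (fun z hz => Real.hasDerivAt_arcsin (by linarith [hz.1]) (by linarith [hz.2]))
    fun z _ => by positivity

theorem one_sub_sq_le_one_sub_sq_mul_sq {p r z : ℝ} (hp : |p| ≤ r) (hz : z ∈ Icc (0 : ℝ) 1) :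
    1 - r ^ 2 ≤ 1 - p ^ 2 * z ^ 2 := by
  have h1 : p ^ 2 ≤ r ^ 2 := sq_le_sq' (by linarith [abs_le.1 hp]) (le_of_abs_le hp)
  have h2 : z ^ 2 ≤ 1 := pow_le_one₀ hz.1 hz.2
  nlinarith [sq_nonneg p]

theorem one_sub_sq_mul_sq_pos {p z : ℝ} (hp : |p| < 1) (hz : z ∈ Icc (0 : ℝ) 1) :
    0 < 1 - p ^ 2 * z ^ 2 := by
  have := one_sub_sq_le_one_sub_sq_mul_sq (le_refl |p|) hz
  have h : |p| ^ 2 < 1 := pow_lt_one₀ (abs_nonneg p) hp two_ne_zero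
  linarith

theorem intervalIntegrable_ellipticK {p : ℝ} (hp : |p| < 1) :
    IntervalIntegrable (fun z : ℝ => 1 / (√(1 - z ^ 2) * √(1 - p ^ 2 * z ^ 2))) volume 0 1 := by
  have hc : ContinuousOn (fun z : ℝ => 1 / √(1 - p ^ 2 * z ^ 2)) (uIcc 0 1) := by
    refine ContinuousOn.div (by fun_prop) (by fun_prop) fun z hz => ?_
    rw [uIcc_of_le zero_le_one] at hz
    exact (Real.sqrt_pos.2 (one_sub_sq_mul_sq_pos hp hz)).ne'
  refine (intervalIntegrable_one_div_sqrt_one_sub_sq.mul_continuousOn hc).congr fun z _ => ?_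
  simp only [one_div, mul_inv]

theorem intervalIntegrable_ellipticE (p : ℝ) :
    IntervalIntegrable (fun z : ℝ => √(1 - p ^ 2 * z ^ 2) / √(1 - z ^ 2)) volume 0 1 := by
  have hc : ContinuousOn (fun z : ℝ => √(1 - p ^ 2 * z ^ 2)) (uIcc 0 1) := by fun_prop
  refine (intervalIntegrable_one_div_sqrt_one_sub_sq.mul_continuousOn hc).congr fun z _ => ?_
  simp only [div_eq_mul_inv, one_mul, mul_comm]

theorem ellipticK_pos {p : ℝ} (hp : |p| < 1) : 0 < ellipticK p := by
  refine intervalIntegral_pos_of_pos_on (intervalIntegrable_ellipticK hp) (fun z hz => ?_)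
    zero_lt_one
  have h1 := one_sub_sq_mul_sq_pos hp (Ioo_subset_Icc_self hz)
  have h2 : 0 < 1 - z ^ 2 := by nlinarith [hz.1, hz.2]
  positivity

/-- The singularity of the integrands at `z = 1` cancels in the combination. -/
theorem sq_mul_ellipticK_sub_ellipticK_add_ellipticE {p : ℝ} (hp : |p| < 1) :
    p ^ 2 * ellipticK p - ellipticK p + ellipticE p =
      ∫ z in (0 : ℝ)..1, p ^ 2 * √(1 - z ^ 2) / √(1 - p ^ 2 * z ^ 2) := by
  have hK := intervalIntegrable_ellipticK hp
  rw [ellipticK, ellipticE, ← intervalIntegral.integral_const_mul, ← integral_sub (hK.const_mul _) hK,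
    ← integral_add ((hK.const_mul _).sub hK) (intervalIntegrable_ellipticE p)]
  refine integral_congr_Ioo_of_le zero_le_one fun z hz => ?_
  have h1 := one_sub_sq_mul_sq_pos hp (Ioo_subset_Icc_self hz)
  have h2 : 0 < 1 - z ^ 2 := by nlinarith [hz.1, hz.2]
  have hs := Real.sq_sqrt h2.le
  have hd := Real.sq_sqrt h1.le
  have hs0 := Real.sqrt_pos.2 h2
  have hd0 := Real.sqrt_pos.2 h1
  set s := √(1 - z ^ 2)
  set d := √(1 - p ^ 2 * z ^ 2)
  field_simp
  rw [hs, hd]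
  ring

theorem hasDerivAt_sq_mul_sqrt_div_sqrt {p z : ℝ} (h : 0 < 1 - p ^ 2 * z ^ 2) :
    HasDerivAt (fun q : ℝ => q ^ 2 * √(1 - z ^ 2) / √(1 - q ^ 2 * z ^ 2))
      (2 * p * √(1 - z ^ 2) / √(1 - p ^ 2 * z ^ 2) +
        p ^ 3 * z ^ 2 * √(1 - z ^ 2) / √(1 - p ^ 2 * z ^ 2) ^ 3) p := by
  have hd0 := Real.sqrt_pos.2 h
  have hsq : HasDerivAt (fun q : ℝ => q ^ 2) (2 * p) p := by simpa using hasDerivAt_pow 2 p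
  have := (hsq.mul_const √(1 - z ^ 2)).div
    (((hsq.mul_const (z ^ 2)).const_sub 1).sqrt h.ne') hd0.ne'
  refine this.congr_deriv ?_
  field_simp
  ring

theorem hasDerivAt_mul_sqrt_div_sqrt {p z : ℝ} (h : 0 < 1 - p ^ 2 * z ^ 2) (hz : 0 < 1 - z ^ 2) :
    HasDerivAt (fun x : ℝ => x * √(1 - x ^ 2) / √(1 - p ^ 2 * x ^ 2))
      ((1 - 2 * z ^ 2 + p ^ 2 * z ^ 4) / (√(1 - z ^ 2) * √(1 - p ^ 2 * z ^ 2) ^ 3)) z := by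
  have hs0 := Real.sqrt_pos.2 hz
  have hd0 := Real.sqrt_pos.2 h
  have hsq : HasDerivAt (fun x : ℝ => x ^ 2) (2 * z) z := by simpa using hasDerivAt_pow 2 z
  have := ((hasDerivAt_id z).mul ((hsq.const_sub 1).sqrt hz.ne')).div
    (((hsq.const_mul (p ^ 2)).const_sub 1).sqrt h.ne') hd0.ne'
  refine this.congr_deriv ?_
  have hs := Real.sq_sqrt hz.le
  have hd := Real.sq_sqrt h.le
  simp only [id, Pi.mul_apply]
  set s := √(1 - z ^ 2)
  set d := √(1 - p ^ 2 * z ^ 2)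
  field_simp
  rw [hs, hd]
  ring

theorem hasDerivAt_combination {p : ℝ} (hp : 0 < p) (hp1 : p < 1) :
    HasDerivAt (fun p => p ^ 2 * ellipticK p - ellipticK p + ellipticE p)
      (p * ellipticK p) p ∧ 0 < p * ellipticK p := by
  have hpa : |p| < 1 := by rwa [abs_of_pos hp]
  refine ⟨?_, mul_pos hp (ellipticK_pos hpa)⟩
  obtain ⟨r, hpr, hr1⟩ := exists_between hp1
  have hr : 0 < √(1 - r ^ 2) := Real.sqrt_pos.2 (by nlinarith)
  have hnhds : Ioo 0 r ∈ 𝓝 p := Ioo_mem_nhds hp hpr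
  have hsub : Ι (0 : ℝ) 1 ⊆ Icc 0 1 := by
    rw [uIoc_of_le zero_le_one]; exact Ioc_subset_Icc_self
  have hd0 : ∀ z ∈ uIcc (0 : ℝ) 1, √(1 - p ^ 2 * z ^ 2) ≠ 0 := fun z hz =>
    (Real.sqrt_pos.2 (one_sub_sq_mul_sq_pos hpa (by rwa [uIcc_of_le zero_le_one] at hz))).ne'
  have hF' : ContinuousOn (fun z : ℝ => 2 * p * √(1 - z ^ 2) / √(1 - p ^ 2 * z ^ 2) +
      p ^ 3 * z ^ 2 * √(1 - z ^ 2) / √(1 - p ^ 2 * z ^ 2) ^ 3) (uIcc 0 1) :=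
    (ContinuousOn.div (by fun_prop) (by fun_prop) hd0).add
      (ContinuousOn.div (by fun_prop) (by fun_prop) fun z hz => pow_ne_zero 3 (hd0 z hz))
  have hF : ContinuousOn (fun z : ℝ => p ^ 2 * √(1 - z ^ 2) / √(1 - p ^ 2 * z ^ 2)) (uIcc 0 1) :=
    ContinuousOn.div (by fun_prop) (by fun_prop) hd0
  obtain ⟨hint, hderiv⟩ := hasDerivAt_integral_of_dominated_loc_of_deriv_le
    (μ := volume) (a := 0) (b := 1)
    (F := fun q z : ℝ => q ^ 2 * √(1 - z ^ 2) / √(1 - q ^ 2 * z ^ 2))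
    (F' := fun q z : ℝ => 2 * q * √(1 - z ^ 2) / √(1 - q ^ 2 * z ^ 2) +
      q ^ 3 * z ^ 2 * √(1 - z ^ 2) / √(1 - q ^ 2 * z ^ 2) ^ 3)
    (bound := fun _ => 2 * 1 * 1 / √(1 - r ^ 2) + 1 * 1 * 1 / √(1 - r ^ 2) ^ 3)
    hnhds (.of_forall fun q => Measurable.aestronglyMeasurable (by fun_prop))
    hF.intervalIntegrable
    hF'.intervalIntegrable.def'.aestronglyMeasurable
    (.of_forall fun z hz q hq => by
      have hz := hsub hz
      have hz0 := hz.1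
      have hq0 := hq.1
      have hq1 : q ≤ 1 := (hq.2.trans hr1).le
      have hrd : √(1 - r ^ 2) ≤ √(1 - q ^ 2 * z ^ 2) := Real.sqrt_le_sqrt
        (one_sub_sq_le_one_sub_sq_mul_sq (by rw [abs_of_pos hq.1]; exact hq.2.le) hz)
      have hs1 : √(1 - z ^ 2) ≤ 1 := Real.sqrt_le_one.2 (by nlinarith [sq_nonneg z])
      have hq3 : q ^ 3 ≤ 1 := pow_le_one₀ hq0.le hq1
      have hz2 : z ^ 2 ≤ 1 := pow_le_one₀ hz.1 hz.2
      rw [Real.norm_of_nonneg (by positivity)]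
      gcongr)
    intervalIntegrable_const
    (.of_forall fun z hz q hq => hasDerivAt_sq_mul_sqrt_div_sqrt
      (one_sub_sq_mul_sq_pos (by rw [abs_of_pos hq.1]; exact hq.2.trans hr1) (hsub hz)))
  have hK := (intervalIntegrable_ellipticK hpa).const_mul p
  have hG : ContinuousOn (fun x : ℝ => x * √(1 - x ^ 2) / √(1 - p ^ 2 * x ^ 2)) (Icc 0 1) := by
    rw [← uIcc_of_le zero_le_one]
    exact ContinuousOn.div (by fun_prop) (by fun_prop) hd0
  have hzero := integral_eq_sub_of_hasDerivAt_of_le zero_le_one (hG.const_smul p)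
    (fun z hz => by
      have h1 := one_sub_sq_mul_sq_pos hpa (Ioo_subset_Icc_self hz)
      have h2 : 0 < 1 - z ^ 2 := by nlinarith [hz.1, hz.2]
      refine ((hasDerivAt_mul_sqrt_div_sqrt h1 h2).const_smul p).congr_deriv ?_
      show _ = (2 * p * √(1 - z ^ 2) / √(1 - p ^ 2 * z ^ 2) +
        p ^ 3 * z ^ 2 * √(1 - z ^ 2) / √(1 - p ^ 2 * z ^ 2) ^ 3) -
        p * (1 / (√(1 - z ^ 2) * √(1 - p ^ 2 * z ^ 2)))
      have hs := Real.sq_sqrt h2.le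
      have hd := Real.sq_sqrt h1.le
      have hs0 := Real.sqrt_pos.2 h2
      have hd0 := Real.sqrt_pos.2 h1
      rw [smul_eq_mul]
      set s := √(1 - z ^ 2)
      set d := √(1 - p ^ 2 * z ^ 2)
      field_simp
      rw [hs, hd]
      ring) (hint.sub hK)
  rw [integral_sub hint hK, intervalIntegral.integral_const_mul] at hzero
  rw [ellipticK, ← sub_eq_zero.1 (hzero.trans (by simp))]
  refine hderiv.congr_of_eventuallyEq ?_
  filter_upwards [hnhds] with q hq
  exact sq_mul_ellipticK_sub_ellipticK_add_ellipticE
    (by rw [abs_of_pos hq.1]; exact hq.2.trans hr1)
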